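/- Let q ≥ 1, b_k > a_k > 0 for k = 1,…,q, 0 < σ ≤ 1 and x > −1. Then (F(σ;(a_q);(b_q);−x))^{1/σ} ≤ F(1;(a_q);(b_q);−x); equivalently, F(σ;(a_q);(b_q);−x) ≤ (F(1;(a_q);(b_q);−x))^σ. -/

import Mathlib

open MeasureTheory Real Filter

/-- Generalized hypergeometric function `F(σ;(a_q);(b_q);−x)` (with `q = n+1` upper/lower
parameter pairs), defined via the multiple Euler integral. -/
noncomputable def hypF {n : ℕ} (σ : ℝ) (a b : Fin (n + 1) → ℝ) (x : ℝ) : ℝ :=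
  (∏ k, Gamma (b k) / (Gamma (a k) * Gamma (b k - a k))) *
    ∫ t : Fin (n + 1) → ℝ in Set.univ.pi fun _ => Set.Icc (0 : ℝ) 1,
      (∏ k, t k ^ (a k - 1) * (1 - t k) ^ (b k - a k - 1)) * (1 + (∏ k, t k) * x) ^ (-σ)

lemma beta_aux {α β : ℝ} (hα : 0 < α) (hβ : 0 < β) :
    IntegrableOn (fun t : ℝ => t ^ (α - 1) * (1 - t) ^ (β - 1)) (Set.Icc 0 1) ∧
    ∫ t in Set.Icc (0:ℝ) 1, t ^ (α - 1) * (1 - t) ^ (β - 1)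
      = Gamma α * Gamma β / Gamma (α + β) := by
  have hc := Complex.betaIntegral_convergent (u := α) (v := β) (by simpa) (by simpa)
  rw [intervalIntegrable_iff_integrableOn_Ioc_of_le (by simp)] at hc
  have hre : ∀ x ∈ Set.Ioc (0:ℝ) 1,
      ((x:ℂ) ^ ((α:ℂ) - 1) * (1 - (x:ℂ)) ^ ((β:ℂ) - 1)).re
        = x ^ (α - 1) * (1 - x) ^ (β - 1) := by
    rintro x ⟨hx1, hx2⟩
    norm_cast
    rw [← Complex.ofReal_cpow, ← Complex.ofReal_cpow,
        Complex.re_mul_ofReal, Complex.ofReal_re]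
    all_goals linarith
  constructor
  · rw [integrableOn_Icc_iff_integrableOn_Ioc]
    exact (IntegrableOn.congr_fun (Integrable.re hc) hre measurableSet_Ioc)
  · have h := ProbabilityTheory.beta_eq_betaIntegralReal α β hα hβ
    rw [ProbabilityTheory.beta, Complex.betaIntegral,
      intervalIntegral.integral_of_le (by norm_num), ← RCLike.re_to_complex, ← integral_re hc] at h
    rw [h, integral_Icc_eq_integral_Ioc]
    exact setIntegral_congr_fun measurableSet_Ioc fun x hx => (hre x hx).symm

lemma box_aux {n : ℕ} (a b : Fin (n + 1) → ℝ) (hab : ∀ k, 0 < a k ∧ a k < b k) :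
    IntegrableOn (fun t : Fin (n + 1) → ℝ =>
      ∏ k, t k ^ (a k - 1) * (1 - t k) ^ (b k - a k - 1))
      (Set.univ.pi fun _ => Set.Icc (0 : ℝ) 1) ∧
    (∏ k, Gamma (b k) / (Gamma (a k) * Gamma (b k - a k))) *
    ∫ t : Fin (n + 1) → ℝ in Set.univ.pi fun _ => Set.Icc (0 : ℝ) 1,
      (∏ k, t k ^ (a k - 1) * (1 - t k) ^ (b k - a k - 1)) = 1 := by
  have h1 := fun k => beta_aux (hab k).1 (sub_pos.2 (hab k).2)
  rw [IntegrableOn, volume_pi, Measure.restrict_pi_pi]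
  constructor
  · exact Integrable.fintype_prod
      (f := fun k (t : ℝ) => t ^ (a k - 1) * (1 - t) ^ (b k - a k - 1)) fun k => (h1 k).1
  · rw [integral_fintype_prod_eq_prod
      (f := fun k (t : ℝ) => t ^ (a k - 1) * (1 - t) ^ (b k - a k - 1)),
      ← Finset.prod_mul_distrib]
    refine Finset.prod_eq_one fun k _ => ?_
    rw [(h1 k).2]
    have e1 := (Gamma_pos_of_pos (hab k).1).ne'
    have e2 := (Gamma_pos_of_pos (sub_pos.2 (hab k).2)).ne'
    have e3 := (Gamma_pos_of_pos ((hab k).1.trans (hab k).2)).ne'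
    rw [add_sub_cancel]
    field_simp

/-- Jensen-type inequality: `(F(σ;(a_q);(b_q);−x))^{1/σ} ≤ F(1;(a_q);(b_q);−x)`, equivalently
`F(σ;(a_q);(b_q);−x) ≤ (F(1;(a_q);(b_q);−x))^σ`, for `0 < σ ≤ 1`. -/
theorem hypF_rpow_inv_le {n : ℕ} (σ : ℝ) (a b : Fin (n + 1) → ℝ)
    (hab : ∀ k, 0 < a k ∧ a k < b k) (hσ0 : 0 < σ) (hσ1 : σ ≤ 1) (x : ℝ) (hx : -1 < x) :
    hypF σ a b x ^ (1 / σ) ≤ hypF 1 a b x ∧ hypF σ a b x ≤ hypF 1 a b x ^ σ := by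
  obtain ⟨hw, hone⟩ := box_aux a b hab
  set K : Set (Fin (n + 1) → ℝ) := Set.univ.pi fun _ => Set.Icc (0 : ℝ) 1 with hK
  set w : (Fin (n + 1) → ℝ) → ℝ :=
    fun t => ∏ k, t k ^ (a k - 1) * (1 - t k) ^ (b k - a k - 1) with hwdef
  set C : ℝ := ∏ k, Gamma (b k) / (Gamma (a k) * Gamma (b k - a k)) with hC
  have hF : ∀ s, hypF s a b x = C * ∫ t in K, w t * (1 + (∏ k, t k) * x) ^ (-s) := fun s => rfl
  have hCpos : 0 < C := Finset.prod_pos fun k _ =>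
    div_pos (Gamma_pos_of_pos ((hab k).1.trans (hab k).2))
      (mul_pos (Gamma_pos_of_pos (hab k).1) (Gamma_pos_of_pos (sub_pos.2 (hab k).2)))
  have hKc : IsCompact K := isCompact_univ_pi fun _ => isCompact_Icc
  have hKm : MeasurableSet K := hKc.isClosed.measurableSet
  have hmem : ∀ t ∈ K, ∀ k, 0 ≤ t k ∧ t k ≤ 1 := fun t ht k => ht k (Set.mem_univ k)
  have hwnn : ∀ t ∈ K, 0 ≤ w t := fun t ht => Finset.prod_nonneg fun k _ =>
    mul_nonneg (rpow_nonneg (hmem t ht k).1 _)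
      (rpow_nonneg (sub_nonneg.2 (hmem t ht k).2) _)
  have hP0 : ∀ t ∈ K, 0 ≤ ∏ k, t k := fun t ht => Finset.prod_nonneg fun k _ => (hmem t ht k).1
  have hP1 : ∀ t ∈ K, ∏ k, t k ≤ 1 := fun t ht =>
    Finset.prod_le_one (fun k _ => (hmem t ht k).1) fun k _ => (hmem t ht k).2
  have hpos : ∀ t ∈ K, 0 < 1 + (∏ k, t k) * x := by
    intro t ht
    have h0 := hP0 t ht
    have h1 := hP1 t ht
    rcases le_or_gt 0 x with h | h
    · positivity
    · nlinarith
  have hint : ∀ s : ℝ, IntegrableOn (fun t => w t * (1 + (∏ k, t k) * x) ^ (-s)) K := by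
    intro s
    refine hw.mul_continuousOn ?_ hKc
    exact ContinuousOn.rpow_const (by fun_prop) fun t ht => Or.inl (hpos t ht).ne'
  have hnn : 0 ≤ hypF σ a b x := by
    rw [hF]
    exact mul_nonneg hCpos.le (setIntegral_nonneg hKm fun t ht =>
      mul_nonneg (hwnn t ht) (rpow_nonneg (hpos t ht).le _))
  have hm : 0 < hypF 1 a b x := by
    have hle : ∫ t in K, w t * (1 + |x|)⁻¹ ≤ ∫ t in K, w t * (1 + (∏ k, t k) * x) ^ (-1:ℝ) := by
      refine setIntegral_mono_on (hw.mul_const _) (hint 1) hKm fun t ht => ?_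
      refine mul_le_mul_of_nonneg_left ?_ (hwnn t ht)
      rw [rpow_neg_one]
      refine inv_anti₀ (hpos t ht) ?_
      have h0 := hP0 t ht
      have h1 := hP1 t ht
      nlinarith [le_abs_self x, abs_nonneg x]
    rw [integral_mul_const] at hle
    have h2 := mul_le_mul_of_nonneg_left hle hCpos.le
    rw [← mul_assoc, hone, one_mul, ← hF] at h2
    exact lt_of_lt_of_le (by positivity) h2
  set m := hypF 1 a b x with hmdef
  have main : hypF σ a b x ≤ m ^ σ := by
    have hle : ∫ t in K, w t * (1 + (∏ k, t k) * x) ^ (-σ) ≤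
        ∫ t in K, (w t * (1 + (∏ k, t k) * x) ^ (-1:ℝ) * (σ * m ^ (σ - 1))
          + w t * ((1 - σ) * m ^ σ)) := by
      refine setIntegral_mono_on (hint σ)
        (((hint 1).mul_const _).add (hw.mul_const _)) hKm fun t ht => ?_
      have hy : 0 ≤ (1 + (∏ k, t k) * x) ^ (-1:ℝ) := rpow_nonneg (hpos t ht).le _
      have hys : (1 + (∏ k, t k) * x) ^ (-σ) = ((1 + (∏ k, t k) * x) ^ (-1:ℝ)) ^ σ := by
        rw [← rpow_mul (hpos t ht).le]; congr 1; ring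
      rw [hys]
      generalize (1 + (∏ k, t k) * x) ^ (-1:ℝ) = y at hy
      have hg := Real.geom_mean_le_arith_mean2_weighted hσ0.le (sub_nonneg.2 hσ1) hy hm.le
        (by ring)
      have hg2 := mul_le_mul_of_nonneg_right hg (rpow_nonneg hm.le (σ - 1))
      have e1 : m ^ (1 - σ) * m ^ (σ - 1) = 1 := by
        rw [← rpow_add hm]; simp
      have e2 : m * m ^ (σ - 1) = m ^ σ := by
        rw [rpow_sub_one hm.ne']; field_simp
      have e3 : y ^ σ ≤ y * (σ * m ^ (σ - 1)) + (1 - σ) * m ^ σ := by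
        calc y ^ σ = y ^ σ * m ^ (1 - σ) * m ^ (σ - 1) := by rw [mul_assoc, e1, mul_one]
          _ ≤ _ := hg2
          _ = y * (σ * m ^ (σ - 1)) + (1 - σ) * (m * m ^ (σ - 1)) := by ring
          _ = _ := by rw [e2]
      calc w t * y ^ σ ≤ w t * (y * (σ * m ^ (σ - 1)) + (1 - σ) * m ^ σ) :=
            mul_le_mul_of_nonneg_left e3 (hwnn t ht)
        _ = _ := by ring
    rw [integral_add ((hint 1).mul_const _) (hw.mul_const _), integral_mul_const,
      integral_mul_const] at hle
    have h2 := mul_le_mul_of_nonneg_left hle hCpos.le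
    rw [← hF, mul_add, ← mul_assoc, ← mul_assoc C (∫ t in K, w t), ← hF, hone, ← hmdef] at h2
    have e2 : m * m ^ (σ - 1) = m ^ σ := by
      rw [rpow_sub_one hm.ne']; field_simp
    calc hypF σ a b x ≤ _ := h2
      _ = σ * (m * m ^ (σ - 1)) + (1 - σ) * m ^ σ := by ring
      _ = m ^ σ := by rw [e2]; ring
  refine ⟨?_, main⟩
  calc hypF σ a b x ^ (1 / σ) ≤ (m ^ σ) ^ (1 / σ) :=
        rpow_le_rpow hnn main (by positivity)
    _ = m := by rw [← rpow_mul hm.le, mul_one_div_cancel hσ0.ne', rpow_one]
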